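/- arXiv:2207.13990 — 2 statements merged into one kernel-verified Lean document; each statement's English description precedes it below -/
import Mathlib

section
/- An infinite compact Hausdorff space K has the finitely supported Josefson–Nissenzweig property if and only if it has the countably supported Josefson–Nissenzweig property; that is, K admits a weak* null sequence of finitely supported signed Radon measures of total variation norm one if and only if it admits a weak* null sequence of countably supported signed Radon measures of total variation norm one. -/
open MeasureTheory Filter Topology Set
open scoped ENNReal

namespace JNP

variable {K : Type*} [TopologicalSpace K] [MeasurableSpace K] [BorelSpace K]

/-- The total variation norm of a signed Borel measure. -/
noncomputable def tvNorm (μ : SignedMeasure K) : ℝ :=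
  (μ.totalVariation Set.univ).toReal

/-- A signed Borel measure is Radon if its total variation is a regular measure. -/
def IsRadon (μ : SignedMeasure K) : Prop :=
  μ.totalVariation.Regular

/-- The integral of a function against a signed measure. -/
noncomputable def integ (μ : SignedMeasure K) (f : K → ℝ) : ℝ :=
  ∫ x, f x ∂μ.toJordanDecomposition.posPart -
    ∫ x, f x ∂μ.toJordanDecomposition.negPart

/-- The support of a signed measure: the set of points all of whose open
neighbourhoods have nonzero total variation. -/
def msupport (μ : SignedMeasure K) : Set K :=
  {x : K | ∀ U : Set K, IsOpen U → x ∈ U → μ.totalVariation U ≠ 0}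

/-- Weak* convergence of a sequence of signed measures: convergence of the integrals of
every continuous real-valued function. -/
def WeakStarTendsto (μs : ℕ → SignedMeasure K) (μ : SignedMeasure K) : Prop :=
  ∀ f : C(K, ℝ), Tendsto (fun n => integ (μs n) f) atTop (𝓝 (integ μ f))

/-- A sequence of signed measures is weak* null if the integral of every continuous
real-valued function tends to `0`. -/
def WeakStarNull (μs : ℕ → SignedMeasure K) : Prop :=
  ∀ f : C(K, ℝ), Tendsto (fun n => integ (μs n) f) atTop (𝓝 (0 : ℝ))

/-- Weak convergence of a sequence of signed measures: convergence under every bounded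
linear functional on the Banach space of signed measures with the total variation norm
(which, for Radon measures, is `C(K)*` by the Riesz representation theorem). -/
def WeakTendsto (μs : ℕ → SignedMeasure K) (μ : SignedMeasure K) : Prop :=
  ∀ φ : SignedMeasure K →ₗ[ℝ] ℝ,
    (∃ C : ℝ, ∀ ν : SignedMeasure K, |φ ν| ≤ C * tvNorm ν) →
    Tendsto (fun n => φ (μs n)) atTop (𝓝 (φ μ))

variable (K) in
/-- The Grothendieck property: every weak* convergent sequence of signed Radon measures
is weakly convergent. -/
def GrothendieckProp : Prop :=
  ∀ (μs : ℕ → SignedMeasure K) (μ : SignedMeasure K),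
    (∀ n, IsRadon (μs n)) → IsRadon μ → WeakStarTendsto μs μ → WeakTendsto μs μ

variable (K) in
/-- The ℓ₁-Grothendieck property: every weak* convergent sequence of countably supported
signed Radon measures is weakly convergent. -/
def Ell1Grothendieck : Prop :=
  ∀ (μs : ℕ → SignedMeasure K) (μ : SignedMeasure K),
    (∀ n, IsRadon (μs n)) → (∀ n, (msupport (μs n)).Countable) →
    IsRadon μ → WeakStarTendsto μs μ → WeakTendsto μs μ

variable (K) in
/-- The Δ-Grothendieck property: every weak* convergent sequence of finitely supported
signed Radon measures is weakly convergent. -/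
def DeltaGrothendieck : Prop :=
  ∀ (μs : ℕ → SignedMeasure K) (μ : SignedMeasure K),
    (∀ n, IsRadon (μs n)) → (∀ n, (msupport (μs n)).Finite) →
    IsRadon μ → WeakStarTendsto μs μ → WeakTendsto μs μ

variable (K) in
/-- The finitely supported Josefson–Nissenzweig property: there is a weak* null sequence of
finitely supported signed Radon measures of total variation norm one. -/
def fsJNP : Prop :=
  ∃ μs : ℕ → SignedMeasure K,
    (∀ n, IsRadon (μs n)) ∧ (∀ n, (msupport (μs n)).Finite) ∧
    (∀ n, tvNorm (μs n) = 1) ∧ WeakStarNull μs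

variable (K) in
/-- The countably supported Josefson–Nissenzweig property: there is a weak* null sequence of
countably supported signed Radon measures of total variation norm one. -/
def csJNP : Prop :=
  ∃ μs : ℕ → SignedMeasure K,
    (∀ n, IsRadon (μs n)) ∧ (∀ n, (msupport (μs n)).Countable) ∧
    (∀ n, tvNorm (μs n) = 1) ∧ WeakStarNull μs

end JNP

namespace JNP

section Concentration

variable {X : Type*} [MeasurableSpace X] [MeasurableSingletonClass X]

/-- A finite measure concentrated on a countable set is concentrated on a finite set up to an
arbitrarily small error. -/
lemma exists_finite_measure_compl_lt (m : Measure X) [IsFiniteMeasure m] {S : Set X}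
    (hS : S.Countable) (hm : m Sᶜ = 0) {ε : ℝ≥0∞} (hε : 0 < ε) :
    ∃ F : Set X, F.Finite ∧ m Fᶜ < ε := by
  have : Countable S := hS.to_subtype
  let A : Finset S → Set X := fun s => (Subtype.val '' (s : Set S))ᶜ
  have hfin (s : Finset S) : (Subtype.val '' (s : Set S)).Finite := s.finite_toSet.image _
  have hA : Antitone A := fun s t hst =>
    compl_subset_compl.2 (image_mono (Finset.coe_subset.2 hst))
  have hI : ⋂ s, A s ⊆ Sᶜ := fun x hx hxS =>
    mem_iInter.1 hx {⟨x, hxS⟩} ⟨⟨x, hxS⟩, by simp, rfl⟩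
  have h := tendsto_measure_iInter_atTop (μ := m)
    (fun s => (hfin s).measurableSet.compl.nullMeasurableSet) hA ⟨∅, measure_ne_top _ _⟩
  rw [measure_mono_null hI hm] at h
  obtain ⟨s, hs⟩ := (h.eventually (gt_mem_nhds hε)).exists
  exact ⟨_, hfin s, hs⟩

end Concentration

section Truncation

variable {X : Type*} [MeasurableSpace X]

/-- The signed measure `c • μ|_F`, defined through its Jordan decomposition. -/
noncomputable def truncate (μ : SignedMeasure X) (F : Set X) (c : NNReal) : SignedMeasure X :=
  (c • (⟨μ.toJordanDecomposition.posPart.restrict F, μ.toJordanDecomposition.negPart.restrict F,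
    (μ.toJordanDecomposition.mutuallySingular.mono_ac
      Measure.restrict_le_self.absolutelyContinuous
      Measure.restrict_le_self.absolutelyContinuous)⟩ : JordanDecomposition X)).toSignedMeasure

lemma truncate_posPart (μ : SignedMeasure X) (F : Set X) (c : NNReal) :
    (truncate μ F c).toJordanDecomposition.posPart =
      c • μ.toJordanDecomposition.posPart.restrict F := by
  rw [truncate, JordanDecomposition.toJordanDecomposition_toSignedMeasure]
  rfl

lemma truncate_negPart (μ : SignedMeasure X) (F : Set X) (c : NNReal) :
    (truncate μ F c).toJordanDecomposition.negPart =
      c • μ.toJordanDecomposition.negPart.restrict F := by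
  rw [truncate, JordanDecomposition.toJordanDecomposition_toSignedMeasure]
  rfl

lemma totalVariation_truncate (μ : SignedMeasure X) (F : Set X) (c : NNReal) :
    (truncate μ F c).totalVariation = c • μ.totalVariation.restrict F := by
  rw [SignedMeasure.totalVariation, truncate_posPart, truncate_negPart,
    SignedMeasure.totalVariation, Measure.restrict_add, smul_add]

lemma tvNorm_truncate (μ : SignedMeasure X) (F : Set X) (c : NNReal) :
    tvNorm (truncate μ F c) = c * μ.totalVariation.real F := by
  rw [tvNorm, totalVariation_truncate, Measure.smul_apply, Measure.restrict_apply_univ,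
    ENNReal.smul_def, smul_eq_mul, ENNReal.toReal_mul, ENNReal.coe_toReal, Measure.real]

lemma integ_truncate (μ : SignedMeasure X) (F : Set X) (c : NNReal) (f : X → ℝ) :
    integ (truncate μ F c) f = c * (∫ x in F, f x ∂μ.toJordanDecomposition.posPart -
      ∫ x in F, f x ∂μ.toJordanDecomposition.negPart) := by
  rw [integ, truncate_posPart, truncate_negPart, integral_smul_nnreal_measure,
    integral_smul_nnreal_measure, NNReal.smul_def, NNReal.smul_def, smul_eq_mul, smul_eq_mul,
    mul_sub]

end Truncation

variable {K : Type*} [TopologicalSpace K] [MeasurableSpace K]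

lemma msupport_eq_support (μ : SignedMeasure K) : msupport μ = μ.totalVariation.support := by
  ext x
  rw [Measure.mem_support_iff_forall]
  refine ⟨fun h U hU => ?_, fun h U hU hx => (h U (hU.mem_nhds hx)).ne'⟩
  obtain ⟨V, hVU, hV, hx⟩ := mem_nhds_iff.1 hU
  exact (pos_iff_ne_zero.2 (h V hV hx)).trans_le (measure_mono hVU)

variable [BorelSpace K]

lemma IsRadon.truncate [R1Space K] {μ : SignedMeasure K} (hμ : IsRadon μ) (F : Set K)
    (c : NNReal) : IsRadon (truncate μ F c) := by
  unfold IsRadon at *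
  rw [totalVariation_truncate]
  have := Measure.Regular.restrict_of_measure_ne_top (measure_ne_top μ.totalVariation F)
  infer_instance

lemma msupport_truncate_subset (μ : SignedMeasure K) {F : Set K} (hF : IsClosed F) (c : NNReal) :
    msupport (truncate μ F c) ⊆ F := by
  intro x hx
  by_contra hxF
  refine hx Fᶜ hF.isOpen_compl hxF ?_
  rw [totalVariation_truncate]
  simp [Measure.restrict_apply hF.isOpen_compl.measurableSet]

lemma abs_integ_truncate_le [CompactSpace K] (μ : SignedMeasure K) {F : Set K}
    (hF : MeasurableSet F) (c : NNReal) (f : C(K, ℝ)) :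
    |integ (truncate μ F c) f| ≤ c * (|integ μ f| + μ.totalVariation.real Fᶜ * ‖f‖) := by
  have key (m : Measure K) [IsFiniteMeasure m] :
      |∫ x, f x ∂m - ∫ x in F, f x ∂m| ≤ m.real Fᶜ * ‖f‖ :=
    norm_integral_sub_setIntegral_le (.of_forall f.norm_coe_le_norm) hF
      (.of_bound f.continuous.measurable.aestronglyMeasurable ‖f‖ (.of_forall f.norm_coe_le_norm))
  have hadd : μ.totalVariation.real Fᶜ = μ.toJordanDecomposition.posPart.real Fᶜ +
      μ.toJordanDecomposition.negPart.real Fᶜ := by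
    rw [SignedMeasure.totalVariation, measureReal_add_apply]
  have hp := abs_le.1 (key μ.toJordanDecomposition.posPart)
  have hn := abs_le.1 (key μ.toJordanDecomposition.negPart)
  rw [integ_truncate, abs_mul, NNReal.abs_eq]
  gcongr
  rw [hadd, add_mul]
  have hi := abs_le.1 (le_refl |integ μ f|)
  unfold integ at *
  exact abs_le.2 ⟨by linarith, by linarith⟩

/-- A countably supported Radon measure of norm one can be replaced by a finitely supported one
whose integrals are controlled by those of the original measure. -/
lemma exists_finite_msupport [CompactSpace K] [T2Space K] {μ : SignedMeasure K} (hμ : IsRadon μ)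
    (hc : (msupport μ).Countable) (h1 : tvNorm μ = 1) {ε : ℝ} (hε : 0 < ε) (hε' : ε ≤ 1 / 2) :
    ∃ ν : SignedMeasure K, IsRadon ν ∧ (msupport ν).Finite ∧ tvNorm ν = 1 ∧
      ∀ f : C(K, ℝ), |integ ν f| ≤ 2 * (|integ μ f| + ε * ‖f‖) := by
  have hS : μ.totalVariation (msupport μ)ᶜ = 0 := by
    have : μ.totalVariation.Regular := hμ
    rw [msupport_eq_support]
    exact Measure.measure_compl_support_of_regular
  obtain ⟨F, hF, hlt⟩ := exists_finite_measure_compl_lt μ.totalVariation hc hS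
    (ENNReal.ofReal_pos.2 hε)
  have hlt' : μ.totalVariation.real Fᶜ < ε :=
    (ENNReal.lt_ofReal_iff_toReal_lt (measure_ne_top _ _)).1 hlt
  have hsum : μ.totalVariation.real F + μ.totalVariation.real Fᶜ = 1 :=
    (measureReal_add_measureReal_compl hF.measurableSet).trans h1
  have hhalf : 1 / 2 ≤ μ.totalVariation.real F := by linarith
  obtain ⟨c, hcF⟩ : ∃ c : NNReal, (c : ℝ) = (μ.totalVariation.real F)⁻¹ :=
    ⟨⟨_, inv_nonneg.2 measureReal_nonneg⟩, rfl⟩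
  have hc2 : (c : ℝ) ≤ 2 := by
    rw [hcF]
    exact inv_le_of_inv_le₀ (by norm_num) (by linarith)
  refine ⟨truncate μ F c, hμ.truncate F c, hF.subset (msupport_truncate_subset μ hF.isClosed c),
    ?_, fun f => (abs_integ_truncate_le μ hF.measurableSet c f).trans ?_⟩
  · rw [tvNorm_truncate, hcF, inv_mul_cancel₀ (by linarith)]
  · gcongr

end JNP

/-- An infinite compact Hausdorff space has the finitely supported Josefson–Nissenzweig
property iff it has the countably supported one. -/
theorem stmt_1 (K : Type*) [TopologicalSpace K] [MeasurableSpace K] [BorelSpace K]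
    [CompactSpace K] [T2Space K] [Infinite K] :
    JNP.fsJNP K ↔ JNP.csJNP K := by
  refine ⟨fun ⟨μs, hR, hF, h1, h0⟩ => ⟨μs, hR, fun n => (hF n).countable, h1, h0⟩, ?_⟩
  rintro ⟨μs, hR, hC, h1, h0⟩
  choose ν hνR hνF hν1 hν using fun n => JNP.exists_finite_msupport (hR n) (hC n) (h1 n)
    (ε := 1 / 2 * (1 / ((n : ℝ) + 1))) (by positivity)
    (mul_le_of_le_one_right (by norm_num) ((div_le_one (by positivity)).2 (by simp)))
  refine ⟨ν, hνR, hνF, hν1, fun f => squeeze_zero_norm (fun n => hν n f) ?_⟩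
  simpa using ((h0 f).abs.add
    ((tendsto_one_div_add_atTop_nhds_zero_nat.const_mul (1 / 2 : ℝ)).mul_const ‖f‖)).const_mul 2
end

section
/- An infinite compact Hausdorff space K has the ℓ1-Grothendieck property if and only if K does not have the countably supported Josefson–Nissenzweig property; that is, every weak* convergent sequence of countably supported signed Radon measures on K is weakly convergent if and only if there is no weak* null sequence of countably supported signed Radon measures on K of total variation norm one. -/
open MeasureTheory Filter Topology Set
open scoped ENNReal

namespace JNP

/-- Schur property of `ℓ₁`: a sequence of unit vectors of `ℓ₁` is not weakly null. -/
theorem not_tendsto_tsum_mul_of_tsum_abs_eq_one {ι : Type*} (a : ℕ → ι → ℝ)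
    (ha : ∀ n, Summable fun i => |a n i|) (ha1 : ∀ n, ∑' i, |a n i| = 1) :
    ¬ ∀ g : ι → ℝ, (∀ i, |g i| ≤ 1) → Tendsto (fun n => ∑' i, a n i * g i) atTop (𝓝 0) := by
  classical
  intro h
  have hle : ∀ n i (g : ι → ℝ), (∀ i, |g i| ≤ 1) → |a n i * g i| ≤ |a n i| := fun n i g hg => by
    rw [abs_mul]
    exact mul_le_of_le_one_right (abs_nonneg _) (hg i)
  have hsum : ∀ n (g : ι → ℝ), (∀ i, |g i| ≤ 1) → Summable fun i => a n i * g i :=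
    fun n g hg => Summable.of_norm_bounded (ha n) fun i => hle n i g hg
  have hIcc : ∀ (x : ι → Icc (-1 : ℝ) 1) i, |(x i : ℝ)| ≤ 1 := fun x i => abs_le.2 (x i).2
  have hcont : ∀ n, Continuous fun x : ι → Icc (-1 : ℝ) 1 => ∑' i, a n i * (x i : ℝ) := fun n =>
    continuous_tsum (fun i => by fun_prop) (ha n) fun i x => hle n i (fun i => x i) (hIcc x)
  let F : ℕ → Set (ι → Icc (-1 : ℝ) 1) := fun m =>
    {x | ∀ n, m ≤ n → |∑' i, a n i * (x i : ℝ)| ≤ 1 / 2}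
  have hFc : ∀ m, IsClosed (F m) := fun m => by
    simp only [F, ofPred_forall]
    exact isClosed_iInter fun n => isClosed_iInter fun _ =>
      isClosed_le (hcont n).abs continuous_const
  have hFU : ⋃ m, F m = univ := by
    refine eq_univ_of_forall fun x => mem_iUnion.2 ?_
    have := (h (fun i => x i) (hIcc x)).abs
    rw [abs_zero] at this
    obtain ⟨m, hm⟩ := eventually_atTop.1 (this.eventually_le_const (by norm_num : (0 : ℝ) < 1 / 2))
    exact ⟨m, hm⟩
  have : Nonempty (ι → Icc (-1 : ℝ) 1) := ⟨fun _ => ⟨0, by simp⟩⟩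
  obtain ⟨m, x, hx⟩ := nonempty_interior_of_iUnion_of_closed hFc hFU
  obtain ⟨I, u, hu, huF⟩ := isOpen_pi_iff.1 isOpen_interior x hx
  have hsingle : ∀ i, Tendsto (fun n => a n i) atTop (𝓝 0) := fun i => by
    have := h (Pi.single i 1) fun j => by
      by_cases hj : j = i
      · subst hj; simp
      · simp [hj]
    refine this.congr fun n => ?_
    rw [tsum_eq_single i fun j hj => by simp [hj]]
    simp
  have hlim : Tendsto (fun n => 1 / 2 + 2 * ∑ i ∈ I, |a n i|) atTop (𝓝 (1 / 2 + 2 * ∑ i ∈ I, 0)) :=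
    ((tendsto_finsetSum I fun i _ => by simpa using (hsingle i).abs).const_mul 2).const_add _
  refine absurd (ge_of_tendsto hlim ?_ (b := 1)) (by norm_num)
  filter_upwards [eventually_ge_atTop m] with n hn
  have hsgn : ∀ r : ℝ, SignType.sign r * (1 : ℝ) ∈ Icc (-1 : ℝ) 1 := fun r => by
    rcases SignType.sign r with _ | _ | _ <;> simp
  let y : ι → Icc (-1 : ℝ) 1 := fun i => if i ∈ I then x i else ⟨_, hsgn (a n i)⟩
  have hy : y ∈ F m := interior_subset <| huF fun i hi => by
    simpa [y, Finset.mem_coe.1 hi] using (hu i hi).2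
  have hyn := (abs_le.1 (hy n hn)).2
  have hdiff : ∑' i, (|a n i| - a n i * (y i : ℝ)) = ∑ i ∈ I, (|a n i| - a n i * (y i : ℝ)) := by
    refine tsum_eq_sum fun i hi => ?_
    simp [y, hi]
  rw [(ha n).tsum_sub (hsum n _ (hIcc y)), ha1 n] at hdiff
  have hI : ∑ i ∈ I, (|a n i| - a n i * (y i : ℝ)) ≤ 2 * ∑ i ∈ I, |a n i| := by
    rw [Finset.mul_sum]
    refine Finset.sum_le_sum fun i _ => ?_
    linarith [(abs_le.1 (hle n i (fun i => y i) (hIcc y))).1]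
  linarith

section Measures

variable {K : Type*} [MeasurableSpace K]

theorem tvNorm_eq (μ : SignedMeasure K) :
    tvNorm μ = μ.toJordanDecomposition.posPart.real univ +
      μ.toJordanDecomposition.negPart.real univ := by
  rw [tvNorm, SignedMeasure.totalVariation, ← measureReal_def, measureReal_add_apply]

theorem tvNorm_nonneg (μ : SignedMeasure K) : 0 ≤ tvNorm μ := ENNReal.toReal_nonneg

theorem totalVariation_sub_le (μ ν : SignedMeasure K) :
    (μ - ν).totalVariation ≤ μ.totalVariation + ν.totalVariation := by
  simp only [SignedMeasure.totalVariation_eq_variation]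
  exact VectorMeasure.variation_sub_le

theorem totalVariation_smul (c : ℝ) (μ : SignedMeasure K) :
    (c • μ).totalVariation = ‖c‖₊ • μ.totalVariation := by
  simp only [SignedMeasure.totalVariation_eq_variation]
  exact VectorMeasure.variation_smul

theorem totalVariation_singleton [MeasurableSingletonClass K] (μ : SignedMeasure K) (x : K) :
    μ.totalVariation {x} = ‖μ {x}‖ₑ := by
  refine le_antisymm ?_ (μ.enorm_le_totalVariation _)
  rw [SignedMeasure.totalVariation_eq_variation]
  have := VectorMeasure.variation_apply_le_of_forall_enorm_le (μ := μ)
    (m := ‖μ {x}‖ₑ • Measure.dirac x) (measurableSet_singleton x) fun E _ hE => by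
      rcases subset_singleton_iff_eq.1 hE with rfl | rfl <;> simp
  simpa using this

theorem tvNorm_smul (c : ℝ) (μ : SignedMeasure K) : tvNorm (c • μ) = |c| * tvNorm μ := by
  rw [tvNorm, totalVariation_smul, tvNorm, Measure.smul_apply, ENNReal.toReal_smul]
  simp [NNReal.smul_def]

theorem toSignedMeasure_posPart_sub_negPart (μ : SignedMeasure K) :
    μ.toJordanDecomposition.posPart.toSignedMeasure -
      μ.toJordanDecomposition.negPart.toSignedMeasure = μ :=
  μ.toSignedMeasure_toJordanDecomposition

theorem integ_smul_of_nonneg {c : ℝ} (hc : 0 ≤ c) (μ : SignedMeasure K) (f : K → ℝ) :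
    integ (c • μ) f = c * integ μ f := by
  rw [integ, SignedMeasure.toJordanDecomposition_smul_real,
    JordanDecomposition.real_smul_posPart_nonneg _ _ hc,
    JordanDecomposition.real_smul_negPart_nonneg _ _ hc, integral_smul_nnreal_measure,
    integral_smul_nnreal_measure, integ, NNReal.smul_def, NNReal.smul_def,
    Real.coe_toNNReal _ hc, smul_eq_mul, smul_eq_mul, mul_sub]

theorem integ_zero (f : K → ℝ) : integ (0 : SignedMeasure K) f = 0 := by
  simp [integ, SignedMeasure.toJordanDecomposition_zero]

theorem integ_le_tvNorm (μ : SignedMeasure K) (f : K → ℝ) (hf : ∀ x, |f x| ≤ 1) :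
    integ μ f ≤ tvNorm μ := by
  have key : ∀ m : Measure K, IsFiniteMeasure m → |∫ x, f x ∂m| ≤ m.real univ := fun m _ => by
    simpa using norm_integral_le_of_norm_le_const (μ := m) (f := f) (C := 1) (ae_of_all _ hf)
  rw [integ, tvNorm_eq]
  linarith [(abs_le.1 (key μ.toJordanDecomposition.posPart inferInstance)).2,
    (abs_le.1 (key μ.toJordanDecomposition.negPart inferInstance)).1]

variable [TopologicalSpace K]

theorem msupport_sub_subset (μ ν : SignedMeasure K) :
    msupport (μ - ν) ⊆ msupport μ ∪ msupport ν := by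
  intro x hx
  by_contra h
  simp only [mem_union, msupport, mem_ofPred_eq, not_or, not_forall, not_not] at h
  obtain ⟨⟨U, hU, hxU, h0U⟩, V, hV, hxV, h0V⟩ := h
  refine hx (U ∩ V) (hU.inter hV) ⟨hxU, hxV⟩ (le_antisymm ?_ zero_le)
  calc (μ - ν).totalVariation (U ∩ V)
      ≤ μ.totalVariation (U ∩ V) + ν.totalVariation (U ∩ V) := totalVariation_sub_le μ ν _
    _ ≤ μ.totalVariation U + ν.totalVariation V :=
      add_le_add (measure_mono inter_subset_left) (measure_mono inter_subset_right)
    _ = 0 := by rw [h0U, h0V, add_zero]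

theorem msupport_smul_subset (c : ℝ) (μ : SignedMeasure K) :
    msupport (c • μ) ⊆ msupport μ := by
  intro x hx U hU hxU h0
  exact hx U hU hxU (by rw [totalVariation_smul]; simp [h0])

theorem IsRadon.zero : IsRadon (0 : SignedMeasure K) := by
  rw [IsRadon, SignedMeasure.totalVariation_zero]
  infer_instance

theorem IsRadon.smul {μ : SignedMeasure K} (c : ℝ) (hμ : IsRadon μ) : IsRadon (c • μ) := by
  rw [IsRadon, totalVariation_smul]
  have : μ.totalVariation.Regular := hμ
  infer_instance

theorem IsRadon.totalVariation_compl_msupport [T2Space K] {μ : SignedMeasure K}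
    (hμ : IsRadon μ) : μ.totalVariation (msupport μ)ᶜ = 0 := by
  have : μ.totalVariation.Regular := hμ
  have hnull : ∀ x ∈ (msupport μ)ᶜ, ∃ U, IsOpen U ∧ x ∈ U ∧ μ.totalVariation U = 0 := by
    intro x hx
    simpa [msupport] using hx
  have hopen : IsOpen (msupport μ)ᶜ := by
    refine isOpen_iff_forall_mem_open.2 fun x hx => ?_
    obtain ⟨U, hU, hxU, h0⟩ := hnull x hx
    exact ⟨U, fun y hy hys => hys U hU hy h0, hU, hxU⟩
  rw [hopen.measure_eq_iSup_isCompact]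
  simp only [ENNReal.iSup_eq_zero]
  intro C hC hCc
  refine hCc.measure_zero_of_nhdsWithin fun x hx => ?_
  obtain ⟨U, hU, hxU, h0⟩ := hnull x (hC hx)
  exact ⟨U, mem_nhdsWithin_of_mem_nhds (hU.mem_nhds hxU), h0⟩

variable [BorelSpace K]

theorem regular_of_le [T2Space K] {m m' : Measure K} [IsFiniteMeasure m'] [m'.InnerRegular]
    (h : m ≤ m') : m.Regular := by
  have : IsFiniteMeasure m := isFiniteMeasure_of_le m' h
  have : m.InnerRegular := by
    refine ⟨fun U hU r hr => ?_⟩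
    obtain ⟨C, hCU, hC, -, hlt⟩ := hU.exists_isCompact_isClosed_sdiff_lt (measure_ne_top m' U)
      (tsub_pos_of_lt hr).ne'
    refine ⟨C, hCU, hC, ?_⟩
    by_contra! hle
    have h1 : m U ≤ m C + m (U \ C) := by
      rw [← measure_inter_add_sdiff U hC.measurableSet, inter_eq_self_of_subset_right hCU]
    have h2 : m (U \ C) < m U - r := (h _).trans_lt hlt
    have h3 : m U < r + (m U - r) :=
      h1.trans_lt (ENNReal.add_lt_add_of_le_of_lt (measure_ne_top m C) hle h2)
    rw [add_tsub_cancel_of_le hr.le] at h3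
    exact lt_irrefl _ h3
  infer_instance

theorem IsRadon.sub [T2Space K] {μ ν : SignedMeasure K} (hμ : IsRadon μ) (hν : IsRadon ν) :
    IsRadon (μ - ν) := by
  have : μ.totalVariation.Regular := hμ
  have : ν.totalVariation.Regular := hν
  exact regular_of_le (totalVariation_sub_le μ ν)

theorem tsum_totalVariation_singleton [T2Space K] (μ : SignedMeasure K) {S : Set K}
    (hS : S.Countable) : ∑' s : S, μ.totalVariation {(s : K)} = μ.totalVariation S := by
  rw [← measure_biUnion hS (fun x _ y _ hxy => by simpa using hxy)
    fun x _ => measurableSet_singleton x, biUnion_of_singleton]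

theorem summable_abs_singleton [T2Space K] (μ : SignedMeasure K) {S : Set K}
    (hS : S.Countable) : Summable fun s : S => |μ {(s : K)}| := by
  have := ENNReal.summable_toReal (f := fun s : S => μ.totalVariation {(s : K)})
    (by rw [tsum_totalVariation_singleton μ hS]; exact measure_ne_top _ _)
  simpa [totalVariation_singleton] using this

theorem tsum_abs_singleton [T2Space K] (μ : SignedMeasure K) {S : Set K}
    (hS : S.Countable) : ∑' s : S, |μ {(s : K)}| = (μ.totalVariation S).toReal := by
  rw [← tsum_totalVariation_singleton μ hS, ENNReal.tsum_toReal_eq fun _ => measure_ne_top _ _]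
  simp [totalVariation_singleton]

theorem summable_singleton_mul [T2Space K] (μ : SignedMeasure K) {S : Set K} (hS : S.Countable)
    {g : S → ℝ} (hg : ∀ s, |g s| ≤ 1) : Summable fun s : S => |μ {(s : K)} * g s| :=
  (summable_abs_singleton μ hS).of_nonneg_of_le (fun _ => abs_nonneg _) fun s => by
    rw [abs_mul]
    exact mul_le_of_le_one_right (abs_nonneg _) (hg s)

/-- The functional `μ ↦ ∑ g(s) μ({s})` on signed measures, for `g` bounded on a countable set. -/
noncomputable def atomFunctional [T2Space K] {S : Set K} (hS : S.Countable)
    {g : S → ℝ} (hg : ∀ s, |g s| ≤ 1) : SignedMeasure K →ₗ[ℝ] ℝ where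
  toFun μ := ∑' s : S, μ {(s : K)} * g s
  map_add' μ ν := by
    rw [← (summable_singleton_mul μ hS hg).of_abs.tsum_add (summable_singleton_mul ν hS hg).of_abs]
    exact tsum_congr fun s => by rw [add_apply, add_mul]
  map_smul' c μ := by
    rw [RingHom.id_apply, smul_eq_mul, ← tsum_mul_left]
    exact tsum_congr fun s => by rw [smul_apply, smul_eq_mul, mul_assoc]

theorem abs_atomFunctional_le [T2Space K] {S : Set K} (hS : S.Countable)
    {g : S → ℝ} (hg : ∀ s, |g s| ≤ 1) (μ : SignedMeasure K) :
    |atomFunctional hS hg μ| ≤ tvNorm μ := by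
  calc |∑' s : S, μ {(s : K)} * g s| ≤ ∑' s : S, |μ {(s : K)} * g s| :=
        norm_tsum_le_tsum_norm (f := fun s : S => μ {(s : K)} * g s)
          (summable_singleton_mul μ hS hg)
    _ ≤ ∑' s : S, |μ {(s : K)}| :=
      (summable_singleton_mul μ hS hg).tsum_le_tsum (fun s => by
        rw [abs_mul]
        exact mul_le_of_le_one_right (abs_nonneg _) (hg s)) (summable_abs_singleton μ hS)
    _ = (μ.totalVariation S).toReal := tsum_abs_singleton μ hS
    _ ≤ tvNorm μ := ENNReal.toReal_mono (measure_ne_top _ _) (measure_mono (subset_univ S))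

theorem not_csJNP_of_ell1Grothendieck [T2Space K] (h : Ell1Grothendieck K) : ¬ csJNP K := by
  rintro ⟨μs, hR, hc, h1, h0⟩
  have hweak := h μs 0 hR hc IsRadon.zero fun f => by rw [integ_zero]; exact h0 f
  let S : Set K := ⋃ n, msupport (μs n)
  have hS : S.Countable := countable_iUnion hc
  refine not_tendsto_tsum_mul_of_tsum_abs_eq_one (fun n (s : S) => μs n {(s : K)})
    (fun n => summable_abs_singleton _ hS) (fun n => ?_) fun g hg => ?_
  · have hcompl : (μs n).totalVariation Sᶜ = 0 :=
      measure_mono_null (compl_subset_compl.2 (subset_iUnion _ n))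
        (hR n).totalVariation_compl_msupport
    rw [tsum_abs_singleton _ hS, ← h1 n, tvNorm, ← measure_add_measure_compl hS.measurableSet,
      hcompl, add_zero]
  · have := hweak (atomFunctional hS hg) ⟨1, fun ν => by
      rw [one_mul]; exact abs_atomFunctional_le hS hg ν⟩
    rw [map_zero] at this
    exact this

variable [CompactSpace K]

theorem integrable_continuousMap (m : Measure K) [IsFiniteMeasure m] (f : C(K, ℝ)) :
    Integrable f m :=
  f.continuous.integrable_of_hasCompactSupport (HasCompactSupport.of_compactSpace f)

theorem integral_eq_of_toSignedMeasure_sub_eq {a b c d : Measure K} [IsFiniteMeasure a]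
    [IsFiniteMeasure b] [IsFiniteMeasure c] [IsFiniteMeasure d]
    (h : a.toSignedMeasure - b.toSignedMeasure = c.toSignedMeasure - d.toSignedMeasure)
    (f : C(K, ℝ)) : ∫ x, f x ∂a - ∫ x, f x ∂b = ∫ x, f x ∂c - ∫ x, f x ∂d := by
  have hadd : a + d = c + b := by
    rw [← Measure.toSignedMeasure_eq_toSignedMeasure_iff, Measure.toSignedMeasure_add,
      Measure.toSignedMeasure_add]
    exact sub_eq_sub_iff_add_eq_add.1 h
  have hint : ∫ x, f x ∂(a + d) = ∫ x, f x ∂(c + b) := by rw [hadd]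
  rw [integral_add_measure (integrable_continuousMap a f) (integrable_continuousMap d f),
    integral_add_measure (integrable_continuousMap c f) (integrable_continuousMap b f)] at hint
  linarith

theorem integ_sub (μ ν : SignedMeasure K) (f : C(K, ℝ)) :
    integ (μ - ν) f = integ μ f - integ ν f := by
  have := integral_eq_of_toSignedMeasure_sub_eq
    (a := (μ - ν).toJordanDecomposition.posPart) (b := (μ - ν).toJordanDecomposition.negPart)
    (c := μ.toJordanDecomposition.posPart + ν.toJordanDecomposition.negPart)
    (d := μ.toJordanDecomposition.negPart + ν.toJordanDecomposition.posPart) (by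
      rw [toSignedMeasure_posPart_sub_negPart, Measure.toSignedMeasure_add,
        Measure.toSignedMeasure_add, add_sub_add_comm, toSignedMeasure_posPart_sub_negPart,
        ← neg_sub (Measure.toSignedMeasure ν.toJordanDecomposition.posPart),
        toSignedMeasure_posPart_sub_negPart, sub_eq_add_neg]) f
  rw [integral_add_measure (integrable_continuousMap _ f) (integrable_continuousMap _ f),
    integral_add_measure (integrable_continuousMap _ f) (integrable_continuousMap _ f)] at this
  rw [integ, integ, integ, this]
  ring

theorem real_univ_sub_le_integral {m : Measure K} [IsFiniteMeasure m] {C : Set K}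
    (hC : MeasurableSet C) (f : C(K, ℝ)) (hf : ∀ x, |f x| ≤ 1) (hfC : ∀ x ∈ C, f x = 1) :
    m.real univ - 2 * m.real Cᶜ ≤ ∫ x, f x ∂m := by
  have h1 : ∫ x, (1 - f x) ∂m ≤ ∫ x, Cᶜ.indicator (fun _ => (2 : ℝ)) x ∂m := by
    refine integral_mono ((integrable_const 1).sub (integrable_continuousMap m f))
      ((integrable_const 2).indicator hC.compl) fun x => ?_
    by_cases hx : x ∈ C
    · simp [hx, hfC x hx]
    · simp only [mem_compl_iff, hx, not_false_eq_true, indicator_of_mem]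
      linarith [(abs_le.1 (hf x)).1]
  rw [integral_sub (integrable_const 1) (integrable_continuousMap m f),
    integral_indicator hC.compl] at h1
  simp only [integral_const, smul_eq_mul, mul_one, measureReal_restrict_apply_univ] at h1
  linarith

theorem IsRadon.exists_tvNorm_sub_le_integ [T2Space K] {μ : SignedMeasure K} (hμ : IsRadon μ)
    {ε : ℝ} (hε : 0 < ε) :
    ∃ f : C(K, ℝ), (∀ x, |f x| ≤ 1) ∧ tvNorm μ - ε ≤ integ μ f := by
  have : μ.totalVariation.Regular := hμ
  obtain ⟨S, hS, hpos, hneg⟩ := μ.toJordanDecomposition.mutuallySingular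
  have hε' : ENNReal.ofReal (ε / 4) ≠ 0 := by simpa using hε
  obtain ⟨A, hAS, -, hA, hAlt⟩ := hS.compl.exists_isCompact_isClosed_sdiff_lt
    (measure_ne_top μ.totalVariation _) hε'
  obtain ⟨B, hBS, -, hB, hBlt⟩ := hS.exists_isCompact_isClosed_sdiff_lt
    (measure_ne_top μ.totalVariation _) hε'
  obtain ⟨g, hg0, hg1, hg⟩ := exists_continuous_zero_one_of_isClosed hB hA
    (disjoint_compl_left.mono hAS hBS).symm
  have hbound : ∀ {m : Measure K} {T C : Set K}, m ≤ μ.totalVariation → m Tᶜ = 0 →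
      μ.totalVariation (T \ C) < ENNReal.ofReal (ε / 4) → m.real Cᶜ ≤ ε / 4 := by
    intro m T C hm hT hlt
    refine ENNReal.toReal_le_of_le_ofReal (by positivity) ?_
    calc m Cᶜ ≤ m (Tᶜ ∪ T \ C) := measure_mono fun x hx => by
            by_cases hxT : x ∈ T
            · exact Or.inr ⟨hxT, hx⟩
            · exact Or.inl hxT
      _ ≤ m Tᶜ + m (T \ C) := measure_union_le _ _
      _ ≤ ENNReal.ofReal (ε / 4) := by rw [hT, zero_add]; exact (hm _).trans hlt.le
  let f : C(K, ℝ) := (2 : ℝ) • g - 1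
  have hf : ∀ x, f x = 2 * g x - 1 := fun x => by simp [f]
  have hf1 : ∀ x, |f x| ≤ 1 := fun x => by
    rw [hf, abs_le]
    constructor <;> linarith [(hg x).1, (hg x).2]
  refine ⟨f, hf1, ?_⟩
  have hp := real_univ_sub_le_integral (m := μ.toJordanDecomposition.posPart) hA.measurableSet f
    hf1 fun x hx => by rw [hf, hg1 hx]; norm_num
  have hn := real_univ_sub_le_integral (m := μ.toJordanDecomposition.negPart) hB.measurableSet (-f)
    (fun x => by simpa using hf1 x) fun x hx => by
      rw [ContinuousMap.neg_apply, hf, hg0 hx]; norm_num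
  simp only [ContinuousMap.neg_apply, integral_neg] at hn
  have hpA := hbound (m := μ.toJordanDecomposition.posPart) (T := Sᶜ) (C := A)
    (Measure.le_add_right le_rfl) (by rwa [compl_compl]) hAlt
  have hnB := hbound (m := μ.toJordanDecomposition.negPart) (T := S) (C := B)
    (Measure.le_add_left le_rfl) hneg hBlt
  rw [integ, tvNorm_eq]
  linarith

/-- Total variation norm is weak* lower semicontinuous along weak* convergent sequences. -/
theorem tvNorm_sub_le_of_weakStarTendsto [T2Space K] {μs : ℕ → SignedMeasure K}
    {μ ν : SignedMeasure K} (hμ : IsRadon μ) (hν : IsRadon ν) (hlim : WeakStarTendsto μs μ)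
    {δ : ℝ} (hδ : ∀ᶠ m in atTop, tvNorm (ν - μs m) ≤ δ) : tvNorm (ν - μ) ≤ δ := by
  refine le_of_forall_pos_le_add fun ε hε => ?_
  obtain ⟨f, hf, hfε⟩ := (hν.sub hμ).exists_tvNorm_sub_le_integ hε
  have hle : integ (ν - μ) f ≤ δ := by
    rw [integ_sub]
    refine le_of_tendsto ((hlim f).const_sub _) ?_
    filter_upwards [hδ] with m hm
    rw [← integ_sub]
    exact (integ_le_tvNorm _ f hf).trans hm
  linarith

theorem csJNP_of_not_cauchy [T2Space K] {μs : ℕ → SignedMeasure K} {μ : SignedMeasure K}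
    (hR : ∀ n, IsRadon (μs n)) (hc : ∀ n, (msupport (μs n)).Countable)
    (hlim : WeakStarTendsto μs μ) {ε : ℝ} (hε : 0 < ε)
    (h : ∀ N, ∃ n m, N ≤ n ∧ N ≤ m ∧ ε < tvNorm (μs n - μs m)) : csJNP K := by
  choose p q hp hq hpq using h
  have hpos : ∀ k, 0 < tvNorm (μs (p k) - μs (q k)) := fun k => hε.trans (hpq k)
  refine ⟨fun k => (tvNorm (μs (p k) - μs (q k)))⁻¹ • (μs (p k) - μs (q k)),
    fun k => ((hR _).sub (hR _)).smul _,
    fun k => ((hc (p k)).union (hc (q k))).mono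
      ((msupport_smul_subset _ _).trans (msupport_sub_subset _ _)),
    fun k => ?_, fun f => ?_⟩
  · rw [tvNorm_smul, abs_of_pos (inv_pos.2 (hpos k)), inv_mul_cancel₀ (hpos k).ne']
  · have hdiff : Tendsto (fun k => integ (μs (p k) - μs (q k)) f) atTop (𝓝 0) := by
      simp only [integ_sub]
      rw [← sub_self (integ μ f)]
      exact ((hlim f).comp (tendsto_atTop_mono hp tendsto_id)).sub
        ((hlim f).comp (tendsto_atTop_mono hq tendsto_id))
    have hbound := (hdiff.abs).const_mul ε⁻¹
    rw [abs_zero, mul_zero] at hbound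
    refine squeeze_zero_norm (fun k => ?_) hbound
    rw [integ_smul_of_nonneg (inv_pos.2 (hpos k)).le, Real.norm_eq_abs, abs_mul,
      abs_of_pos (inv_pos.2 (hpos k))]
    exact mul_le_mul_of_nonneg_right (inv_anti₀ hε (hpq k).le) (abs_nonneg _)

theorem ell1Grothendieck_of_not_csJNP [T2Space K] (h : ¬ csJNP K) : Ell1Grothendieck K := by
  intro μs μ hR hc hμ hlim φ ⟨C, hC⟩
  have hcauchy : ∀ ε > 0, ∃ N, ∀ n m, N ≤ n → N ≤ m → tvNorm (μs n - μs m) ≤ ε := by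
    intro ε hε
    by_contra! hcon
    exact h (csJNP_of_not_cauchy hR hc hlim hε hcon)
  have hnorm : Tendsto (fun n => tvNorm (μs n - μ)) atTop (𝓝 0) := by
    refine tendsto_order.2 ⟨fun a ha => Eventually.of_forall fun n =>
      ha.trans_le (tvNorm_nonneg _), fun a ha => ?_⟩
    obtain ⟨N, hN⟩ := hcauchy (a / 2) (half_pos ha)
    filter_upwards [eventually_ge_atTop N] with n hn
    refine (tvNorm_sub_le_of_weakStarTendsto hμ (hR n) hlim ?_).trans_lt (half_lt_self ha)
    filter_upwards [eventually_ge_atTop N] with m hm using hN n m hn hm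
  rw [tendsto_iff_norm_sub_tendsto_zero]
  refine squeeze_zero (fun _ => norm_nonneg _) (fun n => ?_) (by simpa using hnorm.const_mul C)
  rw [← map_sub]
  exact hC _

end Measures

end JNP

/-- An infinite compact Hausdorff space has the ℓ₁-Grothendieck property iff it does not
have the countably supported Josefson–Nissenzweig property. -/
theorem stmt_2 (K : Type*) [TopologicalSpace K] [MeasurableSpace K] [BorelSpace K]
    [CompactSpace K] [T2Space K] [Infinite K] :
    JNP.Ell1Grothendieck K ↔ ¬ JNP.csJNP K := by
  exact ⟨JNP.not_csJNP_of_ell1Grothendieck, JNP.ell1Grothendieck_of_not_csJNP⟩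
end
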